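/- arXiv:1411.1822 — 3 statements merged into one kernel-verified Lean document; each statement's English description precedes it below -/
import Mathlib

section
/- Let C be a linear octonary code of length n that is self-dual (C = C^⊥). Then C⁽⁴⁾ = (C⁽¹⁾)^⊥, where the dual is taken inside (Fin n → ZMod 2) with respect to the mod-2 inner product, and C⁽³⁾ = (C⁽²⁾)^⊥, where the dual is taken inside (Fin n → ZMod 4) with respect to the mod-4 inner product. -/
open Finset


/-- Coordinatewise reduction mod 2 of an octonary vector. -/
def red2 {n : ℕ} (c : Fin n → ZMod 8) : Fin n → ZMod 2 :=
  fun i => ZMod.castHom (show (2 : ℕ) ∣ 8 by norm_num) (ZMod 2) (c i)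

/-- Coordinatewise reduction mod 4 of an octonary vector. -/
def red4 {n : ℕ} (c : Fin n → ZMod 8) : Fin n → ZMod 4 :=
  fun i => ZMod.castHom (show (4 : ℕ) ∣ 8 by norm_num) (ZMod 4) (c i)

/-- `μ₂ : ZMod 4 → ZMod 8`, sending `v` to `2·(an integer lift of v)`. -/
def mu2 (v : ZMod 4) : ZMod 8 := 2 * (v.val : ZMod 8)

/-- `μ₄ : ZMod 2 → ZMod 8`, sending `v` to `4·(an integer lift of v)`. -/
def mu4 (v : ZMod 2) : ZMod 8 := 4 * (v.val : ZMod 8)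

/-- The reduction code C⁽¹⁾. -/
def codeC1 {n : ℕ} (C : Set (Fin n → ZMod 8)) : Set (Fin n → ZMod 2) := red2 '' C

/-- The reduction code C⁽²⁾. -/
def codeC2 {n : ℕ} (C : Set (Fin n → ZMod 8)) : Set (Fin n → ZMod 4) := red4 '' C

/-- The torsion code C⁽³⁾. -/
def codeC3 {n : ℕ} (C : Set (Fin n → ZMod 8)) : Set (Fin n → ZMod 4) :=
  {v | (fun i => mu2 (v i)) ∈ C}

/-- The torsion code C⁽⁴⁾. -/
def codeC4 {n : ℕ} (C : Set (Fin n → ZMod 8)) : Set (Fin n → ZMod 2) :=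
  {v | (fun i => mu4 (v i)) ∈ C}


/-- Dual of a code over `ZMod q` with respect to the standard inner product. -/
def dualCode {n q : ℕ} (D : Set (Fin n → ZMod q)) : Set (Fin n → ZMod q) :=
  {x | ∀ c ∈ D, ∑ i, x i * c i = 0}

/-- A code is self-dual if it equals its dual. -/
def SelfDual {n q : ℕ} (D : Set (Fin n → ZMod q)) : Prop := D = dualCode D

theorem mu2_add : ∀ a b : ZMod 4, mu2 (a + b) = mu2 a + mu2 b := by decide

theorem mu2_eq_zero_iff : ∀ a : ZMod 4, mu2 a = 0 ↔ a = 0 := by decide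

theorem mu2_mul_castHom : ∀ (a : ZMod 4) (c : ZMod 8),
    mu2 (a * ZMod.castHom (show (4 : ℕ) ∣ 8 by norm_num) (ZMod 4) c) = mu2 a * c := by
  decide

theorem sum_mu2_mul {n : ℕ} (v : Fin n → ZMod 4) (c : Fin n → ZMod 8) :
    ∑ i, mu2 (v i) * c i = mu2 (∑ i, v i * red4 c i) := by
  have h := map_sum (AddMonoidHom.mk' mu2 mu2_add) (fun i => v i * red4 c i) univ
  simp only [AddMonoidHom.mk'_apply] at h
  rw [h]
  exact sum_congr rfl fun i _ => (mu2_mul_castHom (v i) (c i)).symm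

theorem codeC3_eq_dualCode_codeC2 {n : ℕ} {C : Set (Fin n → ZMod 8)} (hC : SelfDual C) :
    codeC3 C = dualCode (codeC2 C) := by
  ext v
  have h : (fun i => mu2 (v i)) ∈ C ↔ (fun i => mu2 (v i)) ∈ dualCode C :=
    Set.ext_iff.mp hC _
  simp only [codeC3, codeC2, Set.mem_ofPred_eq, h]
  simp only [dualCode, Set.mem_ofPred_eq, Set.forall_mem_image, sum_mu2_mul, mu2_eq_zero_iff]

theorem mu4_add : ∀ a b : ZMod 2, mu4 (a + b) = mu4 a + mu4 b := by decide

theorem mu4_eq_zero_iff : ∀ a : ZMod 2, mu4 a = 0 ↔ a = 0 := by decide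

theorem mu4_mul_castHom : ∀ (a : ZMod 2) (c : ZMod 8),
    mu4 (a * ZMod.castHom (show (2 : ℕ) ∣ 8 by norm_num) (ZMod 2) c) = mu4 a * c := by
  decide

theorem sum_mu4_mul {n : ℕ} (v : Fin n → ZMod 2) (c : Fin n → ZMod 8) :
    ∑ i, mu4 (v i) * c i = mu4 (∑ i, v i * red2 c i) := by
  have h := map_sum (AddMonoidHom.mk' mu4 mu4_add) (fun i => v i * red2 c i) univ
  simp only [AddMonoidHom.mk'_apply] at h
  rw [h]
  exact sum_congr rfl fun i _ => (mu4_mul_castHom (v i) (c i)).symm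

theorem codeC4_eq_dualCode_codeC1 {n : ℕ} {C : Set (Fin n → ZMod 8)} (hC : SelfDual C) :
    codeC4 C = dualCode (codeC1 C) := by
  ext v
  have h : (fun i => mu4 (v i)) ∈ C ↔ (fun i => mu4 (v i)) ∈ dualCode C :=
    Set.ext_iff.mp hC _
  simp only [codeC4, codeC1, Set.mem_ofPred_eq, h]
  simp only [dualCode, Set.mem_ofPred_eq, Set.forall_mem_image, sum_mu4_mul, mu4_eq_zero_iff]

theorem torsion_eq_dual_reduction_of_selfDual
    (n : ℕ) (C : Submodule (ZMod 8) (Fin n → ZMod 8))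
    (hC : SelfDual (C : Set (Fin n → ZMod 8))) :
    codeC4 (C : Set (Fin n → ZMod 8)) = dualCode (codeC1 (C : Set (Fin n → ZMod 8))) ∧
    codeC3 (C : Set (Fin n → ZMod 8)) = dualCode (codeC2 (C : Set (Fin n → ZMod 8))) := by
  exact ⟨codeC4_eq_dualCode_codeC1 hC, codeC3_eq_dualCode_codeC2 hC⟩
end

section
/- Let m₁, …, m₇ be natural numbers, let n = m₁ + m₂ + ⋯ + m₇, and let BRep be the block repetition code of length n over ZMod 8 generated (as a Z8-submodule of (Fin n → ZMod 8)) by the single vector g whose first m₁ coordinates are 1, next m₂ coordinates are 2, next m₃ coordinates are 3, next m₄ coordinates are 4, next m₅ coordinates are 5, next m₆ coordinates are 6, and last m₇ coordinates are 7 (so BRep = {k·g : k ∈ ZMod 8}). Then min{2m₁+2m₂+2m₃+2m₄+2m₅+2m₆+2m₇, 2m₂+2m₃+2m₄+4m₅+2m₆+2m₇, 2m₁+2m₂+2m₄+2m₅+2m₆+4m₇, 4m₁+2m₂+2m₃+2m₄+2m₆+2m₇, 2m₁+2m₂+4m₃+2m₄+2m₅+2m₆} ≤ r_HW(BRep) ≤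 11·(m₁ + m₃ + m₅ + m₇) + 12·(m₂ + m₆) + 16·m₄. -/
open Finset

/-- Homogeneous weight on `ZMod 8`. -/
def wHW (x : ZMod 8) : ℕ := if x = 0 then 0 else if x = 4 then 4 else 2

/-- Lee weight on `ZMod 8`. -/
def wL (x : ZMod 8) : ℕ := min x.val (8 - x.val)

/-- Euclidean weight on `ZMod 8`. -/
def wE (x : ZMod 8) : ℕ := min (x.val ^ 2) ((8 - x.val) ^ 2)

/-- The distance on `Fin n → ZMod 8` induced by a weight `w` on `ZMod 8`. -/
def distOf (w : ZMod 8 → ℕ) {n : ℕ} (x y : Fin n → ZMod 8) : ℕ := ∑ i, w (x i - y i)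

/-- The covering radius of a code `C ⊆ α` with respect to a distance `d`:
the maximum over all `u` of the minimum distance from `u` to the code. -/
noncomputable def covRadius {α : Type*} [Fintype α] (d : α → α → ℕ) (C : Set α) : ℕ :=
  ⨆ u : α, sInf {r | ∃ c ∈ C, r = d u c}

/-- The generator of the block repetition code: first `m₁` coordinates `1`,
next `m₂` coordinates `2`, …, last `m₇` coordinates `7`. -/
def blockVec (m₁ m₂ m₃ m₄ m₅ m₆ m₇ : ℕ) :
    Fin (m₁ + m₂ + m₃ + m₄ + m₅ + m₆ + m₇) → ZMod 8 := fun i =>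
  if (i : ℕ) < m₁ then 1
  else if (i : ℕ) < m₁ + m₂ then 2
  else if (i : ℕ) < m₁ + m₂ + m₃ then 3
  else if (i : ℕ) < m₁ + m₂ + m₃ + m₄ then 4
  else if (i : ℕ) < m₁ + m₂ + m₃ + m₄ + m₅ then 5
  else if (i : ℕ) < m₁ + m₂ + m₃ + m₄ + m₅ + m₆ then 6
  else 7

theorem wHW_le_four (x : ZMod 8) : wHW x ≤ 4 := by
  revert x; decide

/-- Summing over the coordinates of `blockVec` groups into its seven blocks. -/
theorem sum_comp_blockVec (m₁ m₂ m₃ m₄ m₅ m₆ m₇ : ℕ) (f : ZMod 8 → ℕ) :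
    ∑ i, f (blockVec m₁ m₂ m₃ m₄ m₅ m₆ m₇ i) =
      m₁ * f 1 + m₂ * f 2 + m₃ * f 3 + m₄ * f 4 + m₅ * f 5 + m₆ * f 6 + m₇ * f 7 := by
  have sum_block (F : ℕ → ℕ) (m a c : ℕ) (h : ∀ x < m, F (a + x) = c) :
      ∑ x ∈ range m, F (a + x) = m * c := by
    rw [sum_congr rfl fun x hx => h x (mem_range.1 hx)]
    simp
  let F : ℕ → ℕ := fun i => f (
    if i < m₁ then 1
    else if i < m₁ + m₂ then 2
    else if i < m₁ + m₂ + m₃ then 3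
    else if i < m₁ + m₂ + m₃ + m₄ then 4
    else if i < m₁ + m₂ + m₃ + m₄ + m₅ then 5
    else if i < m₁ + m₂ + m₃ + m₄ + m₅ + m₆ then 6
    else 7)
  have hF : ∑ i, f (blockVec m₁ m₂ m₃ m₄ m₅ m₆ m₇ i) = _ :=
    Fin.sum_univ_eq_sum_range F (m₁ + m₂ + m₃ + m₄ + m₅ + m₆ + m₇)
  rw [hF]
  simp only [sum_range_add]
  congr 1; congr 1; congr 1; congr 1; congr 1; congr 1
  · simpa using sum_block F m₁ 0 (f 1) fun x hx => by grind
  all_goals exact sum_block F _ _ _ fun x hx => by grind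

section CovRadius

variable {α : Type*} [Fintype α] {d : α → α → ℕ} {C : Set α}

theorem le_covRadius {b : ℕ} (hC : C.Nonempty) (u : α) (h : ∀ c ∈ C, b ≤ d u c) :
    b ≤ covRadius d C := by
  obtain ⟨c, hc⟩ := hC
  have hne : {r | ∃ c ∈ C, r = d u c}.Nonempty := ⟨d u c, c, hc, rfl⟩
  refine le_trans (le_csInf hne ?_)
    (le_ciSup (f := fun u => sInf {r | ∃ c ∈ C, r = d u c}) (Set.finite_range _).bddAbove u)
  rintro r ⟨c, hc, rfl⟩
  exact h c hc

theorem covRadius_le {b : ℕ} (h : ∀ u, ∃ c ∈ C, d u c ≤ b) : covRadius d C ≤ b := by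
  refine ciSup_le' fun u => ?_
  obtain ⟨c, hc, hb⟩ := h u
  have hmem : d u c ∈ {r | ∃ c ∈ C, r = d u c} := ⟨c, hc, rfl⟩
  exact (Nat.sInf_le hmem).trans hb

end CovRadius

theorem distOf_wHW_le {n : ℕ} (x y : Fin n → ZMod 8) : distOf wHW x y ≤ 4 * n := by
  simpa [distOf, mul_comm] using
    sum_le_card_nsmul univ (fun i => wHW (x i - y i)) 4 fun i _ => wHW_le_four _

theorem covRadius_homogeneous_block_repetition_bounds
    (m₁ m₂ m₃ m₄ m₅ m₆ m₇ : ℕ)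
    (BRep : Submodule (ZMod 8) (Fin (m₁ + m₂ + m₃ + m₄ + m₅ + m₆ + m₇) → ZMod 8))
    (hB : BRep = Submodule.span (ZMod 8) {blockVec m₁ m₂ m₃ m₄ m₅ m₆ m₇}) :
    min (2*m₁ + 2*m₂ + 2*m₃ + 2*m₄ + 2*m₅ + 2*m₆ + 2*m₇)
      (min (2*m₂ + 2*m₃ + 2*m₄ + 4*m₅ + 2*m₆ + 2*m₇)
        (min (2*m₁ + 2*m₂ + 2*m₄ + 2*m₅ + 2*m₆ + 4*m₇)
          (min (4*m₁ + 2*m₂ + 2*m₃ + 2*m₄ + 2*m₆ + 2*m₇)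
            (2*m₁ + 2*m₂ + 4*m₃ + 2*m₄ + 2*m₅ + 2*m₆)))) ≤
      covRadius (distOf wHW)
        (BRep : Set (Fin (m₁ + m₂ + m₃ + m₄ + m₅ + m₆ + m₇) → ZMod 8)) ∧
    covRadius (distOf wHW)
        (BRep : Set (Fin (m₁ + m₂ + m₃ + m₄ + m₅ + m₆ + m₇) → ZMod 8)) ≤
      11 * (m₁ + m₃ + m₅ + m₇) + 12 * (m₂ + m₆) + 16 * m₄ := by
  subst hB
  constructor
  · refine le_covRadius ⟨0, Submodule.zero_mem _⟩ (fun _ => 1) fun c hc => ?_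
    obtain ⟨k, rfl⟩ := Submodule.mem_span_singleton.1 hc
    have hsum := sum_comp_blockVec m₁ m₂ m₃ m₄ m₅ m₆ m₇ fun x => wHW (1 - k * x)
    simp only [distOf, Pi.smul_apply, smul_eq_mul]
    rw [hsum]
    clear hsum hc
    have hk : ∀ k : ZMod 8,
        k = 0 ∨ k = 1 ∨ k = 2 ∨ k = 3 ∨ k = 4 ∨ k = 5 ∨ k = 6 ∨ k = 7 := by decide
    rcases hk k with rfl | rfl | rfl | rfl | rfl | rfl | rfl | rfl <;>
      simp +decide only [wHW, if_true, if_false] <;> omega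
  · refine covRadius_le fun u => ⟨0, Submodule.zero_mem _, (distOf_wHW_le u 0).trans ?_⟩
    omega
end

section
/- Let k be a natural number and let 1 ≤ u < k. For u < r ≤ k, the MacDonald codes of type α satisfy r_E(M_{k,u}^α) ≤ 6·(8^k − 8^r) + r_E(M_{r,u}^α). Here, for 1 ≤ u < k, M_{k,u}^α is the code indexed by T_{k,u} = {v ∈ (Fin k → ZMod 8) : v i ≠ 0 for some i with (i : ℕ) < k − u} given by M_{k,u}^α = {(fun v => Σᵢ x i · v i) restricted to T_{k,u} : x ∈ (Fin k → ZMod 8)} ⊆ (T_{k,u} → ZMod 8), a code of length 8^k − 8^u. -/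
open Finset

/-- The distance induced by a weight `w` on `ι → ZMod 8` for a finite index type `ι`. -/
def distOn {ι : Type*} [Fintype ι] (w : ZMod 8 → ℕ) (x y : ι → ZMod 8) : ℕ :=
  ∑ i, w (x i - y i)

/-- The index set of the MacDonald code `M_{k,u}^α`: the points
`v : Fin k → ZMod 8` that are nonzero in some coordinate `i` with `(i : ℕ) < k - u`. -/
def macIdx (k u : ℕ) : Type :=
  {v : Fin k → ZMod 8 // ∃ i : Fin k, (i : ℕ) < k - u ∧ v i ≠ 0}

instance (k u : ℕ) : Fintype (macIdx k u) :=
  Subtype.fintype _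

instance (k u : ℕ) : DecidableEq (macIdx k u) :=
  Subtype.instDecidableEq

/-- The MacDonald code `M_{k,u}^α` of type α: restrictions of all `ZMod 8`-linear
forms to the index set `macIdx k u`. -/
def macDonaldAlpha (k u : ℕ) : Set (macIdx k u → ZMod 8) :=
  Set.range (fun x : Fin k → ZMod 8 => fun v : macIdx k u => ∑ i, x i * v.1 i)

theorem covRadius_le_s17 {α : Type*} [Fintype α] [Nonempty α] {d : α → α → ℕ} {C : Set α} {N : ℕ}
    (h : ∀ y, ∃ c ∈ C, d y c ≤ N) : covRadius d C ≤ N :=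
  by
  refine ciSup_le fun y => ?_
  obtain ⟨c, hc, hd⟩ := h y
  have hmem : d y c ∈ {r | ∃ c ∈ C, r = d y c} := ⟨c, hc, rfl⟩
  exact (Nat.sInf_le hmem).trans hd

theorem exists_dist_le_covRadius {α : Type*} [Fintype α] (d : α → α → ℕ) {C : Set α}
    (hC : C.Nonempty) (y : α) : ∃ c ∈ C, d y c ≤ covRadius d C := by
  obtain ⟨c₀, hc₀⟩ := hC
  obtain ⟨c, hc, hd⟩ := Nat.sInf_mem (s := {r | ∃ c ∈ C, r = d y c}) ⟨_, c₀, hc₀, rfl⟩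
  refine ⟨c, hc, hd.symm.trans_le ?_⟩
  exact le_ciSup (f := fun u => sInf {r | ∃ c ∈ C, r = d u c}) (Set.finite_range _).bddAbove y

/-- A bound for `∑ t, wE (c - t * s)`, according to the order of `s`. -/
theorem sum_wE_sub_mul_le (c s : ZMod 8) (hs : s ≠ 0) :
    ∑ t, wE (c - t * s) ≤
      44 + (if s ∈ ({0, 2, 4, 6} : Finset (ZMod 8)) then 4 else 0)
        + (if s ∈ ({0, 4} : Finset (ZMod 8)) then 16 else 0) := by
  revert c s
  decide

/-- Averaging over the multiples of a single basis vector. -/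
theorem eight_mul_sum_wE_sub_dotProduct {m : ℕ} (c : ZMod 8) (w : Fin m → ZMod 8) (j : Fin m) :
    8 * ∑ a : Fin m → ZMod 8, wE (c - ∑ i, a i * w i) =
      ∑ a : Fin m → ZMod 8, ∑ t, wE ((c - ∑ i, a i * w i) - t * w j) := by
  rw [Finset.sum_comm]
  have h : ∀ t : ZMod 8, ∑ a : Fin m → ZMod 8, wE ((c - ∑ i, a i * w i) - t * w j) =
      ∑ a : Fin m → ZMod 8, wE (c - ∑ i, a i * w i) := fun t => by
    refine Fintype.sum_equiv (Equiv.addRight (Pi.single j t)) _ _ fun a => ?_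
    simp [add_mul, Finset.sum_add_distrib, Pi.single_apply, sub_sub]
  simp [h, ZMod.card]

theorem eight_mul_sum_wE_le {m : ℕ} (c : ZMod 8) (w : Fin m → ZMod 8) (hw : w ≠ 0) :
    8 * ∑ a : Fin m → ZMod 8, wE (c - ∑ i, a i * w i) ≤
      8 ^ m * (44 + (if w ∈ Fintype.piFinset fun _ => ({0, 2, 4, 6} : Finset (ZMod 8)) then 4 else 0)
        + (if w ∈ Fintype.piFinset fun _ => ({0, 4} : Finset (ZMod 8)) then 16 else 0)) := by
  obtain ⟨j, hj, h₁, h₂⟩ : ∃ j, w j ≠ 0 ∧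
      (w j ∈ ({0, 2, 4, 6} : Finset (ZMod 8)) → ∀ i, w i ∈ ({0, 2, 4, 6} : Finset (ZMod 8))) ∧
      (w j ∈ ({0, 4} : Finset (ZMod 8)) → ∀ i, w i ∈ ({0, 4} : Finset (ZMod 8))) := by
    have hsub : ∀ s : ZMod 8, s ∈ ({0, 4} : Finset (ZMod 8)) →
        s ∈ ({0, 2, 4, 6} : Finset (ZMod 8)) := by decide
    have hzero : (0 : ZMod 8) ∈ ({0, 4} : Finset (ZMod 8)) := by decide
    by_cases hA : ∀ i, w i ∈ ({0, 2, 4, 6} : Finset (ZMod 8))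
    · by_cases hB : ∀ i, w i ∈ ({0, 4} : Finset (ZMod 8))
      · obtain ⟨j, hj⟩ := Function.ne_iff.mp hw
        exact ⟨j, hj, fun _ => hA, fun _ => hB⟩
      · obtain ⟨j, hj⟩ := not_forall.mp hB
        exact ⟨j, fun h => hj (h ▸ hzero), fun _ => hA, fun h => absurd h hj⟩
    · obtain ⟨j, hj⟩ := not_forall.mp hA
      exact ⟨j, fun h => hj (h ▸ hsub 0 hzero), fun h => absurd h hj,
        fun h => absurd (hsub _ h) hj⟩
  rw [eight_mul_sum_wE_sub_dotProduct c w j]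
  refine (Finset.sum_le_card_nsmul _ _ _ fun a _ =>
    (sum_wE_sub_mul_le (c - ∑ i, a i * w i) (w j) hj)).trans ?_
  have hcard : (univ : Finset (Fin m → ZMod 8)).card = 8 ^ m := by simp [ZMod.card]
  rw [hcard, smul_eq_mul]
  simp only [Fintype.mem_piFinset]
  gcongr <;> split_ifs <;> simp_all

theorem sum_order_bound (m : ℕ) :
    ∑ w ∈ (univ : Finset (Fin m → ZMod 8)).erase 0,
      (44 + (if w ∈ Fintype.piFinset fun _ => ({0, 2, 4, 6} : Finset (ZMod 8)) then 4 else 0)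
        + (if w ∈ Fintype.piFinset fun _ => ({0, 4} : Finset (ZMod 8)) then 16 else 0)) ≤
      48 * (8 ^ m - 1) := by
  have h4 : ({0, 2, 4, 6} : Finset (ZMod 8)).card = 4 := by decide
  have h2 : ({0, 4} : Finset (ZMod 8)).card = 2 := by decide
  have hcard : (univ : Finset (Fin m → ZMod 8)).card = 8 ^ m := by simp [ZMod.card]
  rw [Finset.sum_add_distrib, Finset.sum_add_distrib, Finset.sum_ite_mem, Finset.sum_ite_mem]
  simp only [Finset.erase_inter, Finset.univ_inter, Finset.sum_const, smul_eq_mul]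
  rw [Finset.card_erase_of_mem (Finset.mem_univ _), Finset.card_erase_of_mem (by simp),
    Finset.card_erase_of_mem (by simp), Fintype.card_piFinset_const, Fintype.card_piFinset_const,
    h4, h2, hcard]
  have h : 4 ^ m + 4 * 2 ^ m ≤ 8 ^ m + 4 := by
    have e4 : (4 : ℕ) ^ m = 2 ^ m * 2 ^ m := by rw [← mul_pow]; norm_num
    have e8 : (8 : ℕ) ^ m = 2 ^ m * 2 ^ m * 2 ^ m := by rw [← mul_pow, ← mul_pow]; norm_num
    rw [e4, e8]
    obtain rfl | hm := Nat.eq_zero_or_pos m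
    · simp
    · obtain ⟨x, hx⟩ : ∃ x, 2 ^ m = 2 + x :=
        Nat.exists_eq_add_of_le (by simpa using Nat.pow_le_pow_right two_pos hm)
      rw [hx]
      nlinarith [sq_nonneg x, Nat.zero_le (x ^ 3)]
  have p2 := Nat.pow_pos (n := m) (show 0 < 2 by norm_num)
  have p4 := Nat.pow_pos (n := m) (show 0 < 4 by norm_num)
  have p8 := Nat.pow_pos (n := m) (show 0 < 8 by norm_num)
  generalize 2 ^ m = x, 4 ^ m = y, 8 ^ m = z at *
  omega

/-- On the coordinates with nonzero projection, some linear form has average distance at most `6`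
from any given table of values. -/
theorem exists_sum_wE_le (m : ℕ) {β : Type*} [Fintype β] (G : (Fin m → ZMod 8) → β → ZMod 8) :
    ∃ a : Fin m → ZMod 8, ∑ w ∈ (univ : Finset (Fin m → ZMod 8)).erase 0, ∑ z,
      wE (G w z - ∑ i, a i * w i) ≤ 6 * (8 ^ m - 1) * Fintype.card β := by
  have hcard : (univ : Finset (Fin m → ZMod 8)).card = 8 ^ m := by simp [ZMod.card]
  have h : ∑ a : Fin m → ZMod 8, ∑ w ∈ (univ : Finset (Fin m → ZMod 8)).erase 0, ∑ z,
      wE (G w z - ∑ i, a i * w i) ≤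
        ∑ _a : Fin m → ZMod 8, 6 * (8 ^ m - 1) * Fintype.card β := by
    refine Nat.le_of_mul_le_mul_left (c := 8) ?_ (by norm_num)
    rw [Finset.sum_comm, Finset.mul_sum]
    calc _ ≤ ∑ w ∈ (univ : Finset (Fin m → ZMod 8)).erase 0, Fintype.card β * (8 ^ m *
          (44 + (if w ∈ Fintype.piFinset fun _ => ({0, 2, 4, 6} : Finset (ZMod 8)) then 4 else 0)
            + (if w ∈ Fintype.piFinset fun _ => ({0, 4} : Finset (ZMod 8)) then 16 else 0))) := by
          refine Finset.sum_le_sum fun w hw => ?_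
          rw [Finset.sum_comm, Finset.mul_sum]
          exact Finset.sum_le_card_nsmul _ _ _ fun z _ =>
            eight_mul_sum_wE_le (G w z) w (Finset.ne_of_mem_erase hw)
      _ ≤ Fintype.card β * (8 ^ m * (48 * (8 ^ m - 1))) := by
          rw [← Finset.mul_sum, ← Finset.mul_sum]
          exact Nat.mul_le_mul_left _ (Nat.mul_le_mul_left _ (sum_order_bound m))
      _ = _ := by
          rw [Finset.sum_const, hcard, smul_eq_mul]
          ring
  obtain ⟨a, -, ha⟩ := Finset.exists_le_of_sum_le Finset.univ_nonempty h
  exact ⟨a, ha⟩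

theorem distOn_macIdx (k u : ℕ) (w : ZMod 8 → ℕ) (Y X : (Fin k → ZMod 8) → ZMod 8) :
    distOn w (fun v : macIdx k u => Y v.1) (fun v => X v.1) =
      ∑ v : Fin k → ZMod 8,
        if ∃ i : Fin k, (i : ℕ) < k - u ∧ v i ≠ 0 then w (Y v - X v) else 0 := by
  rw [← Finset.sum_filter]
  exact (Finset.sum_subtype (p := fun v : Fin k → ZMod 8 => ∃ i : Fin k, (i : ℕ) < k - u ∧ v i ≠ 0)
    _ (by simp) (fun v => w (Y v - X v))).symm

theorem sum_eq_sum_append {m r : ℕ} {α M : Type*} [Fintype α] [AddCommMonoid M]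
    (f : (Fin (m + r) → α) → M) :
    ∑ v, f v = ∑ w : Fin m → α, ∑ z : Fin r → α, f (Fin.append w z) := by
  rw [← (Fin.appendEquiv m r).sum_comp, Fintype.sum_prod_type]
  rfl

theorem exists_append_ne_zero_iff {m r u : ℕ} (hur : u ≤ r) (w : Fin m → ZMod 8)
    (z : Fin r → ZMod 8) :
    (∃ i : Fin (m + r), (i : ℕ) < m + r - u ∧ Fin.append w z i ≠ 0) ↔
      w ≠ 0 ∨ ∃ i : Fin r, (i : ℕ) < r - u ∧ z i ≠ 0 := by
  rw [Nat.add_sub_assoc hur, Function.ne_iff]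
  constructor
  · rintro ⟨i, hi, hne⟩
    induction i using Fin.addCases with
    | left i => exact Or.inl ⟨i, by simpa using hne⟩
    | right i => exact Or.inr ⟨i, by simpa using hi, by simpa using hne⟩
  · rintro (⟨i, hi⟩ | ⟨i, hi, hne⟩)
    · exact ⟨Fin.castAdd r i, by simp; omega, by simpa using hi⟩
    · exact ⟨Fin.natAdd m i, by simpa using hi, by simpa using hne⟩

theorem covRadius_macDonaldAlpha
    (k u r : ℕ) (hu : 1 ≤ u) (huk : u < k) (hur : u < r) (hrk : r ≤ k) :
    covRadius (distOn wE) (macDonaldAlpha k u) ≤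
      6 * (8 ^ k - 8 ^ r) + covRadius (distOn wE) (macDonaldAlpha r u) := by
  obtain ⟨m, rfl⟩ := Nat.exists_eq_add_of_le' hrk
  refine covRadius_le_s17 fun y => ?_
  obtain ⟨Y, rfl⟩ : ∃ Y : (Fin (m + r) → ZMod 8) → ZMod 8,
      y = fun v : macIdx (m + r) u => Y v.1 := by
    classical
    refine ⟨fun v => if h : ∃ i : Fin (m + r), (i : ℕ) < m + r - u ∧ v i ≠ 0 then y ⟨v, h⟩ else 0,
      funext fun v => ?_⟩
    exact (dif_pos v.2 : (if h : ∃ i : Fin (m + r), (i : ℕ) < m + r - u ∧ v.1 i ≠ 0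
      then y ⟨v.1, h⟩ else 0) = y v).symm
  obtain ⟨_, ⟨b, rfl⟩, hb⟩ := exists_dist_le_covRadius (distOn wE) (C := macDonaldAlpha r u)
    (Set.range_nonempty _) (fun z => Y (Fin.append 0 z.1))
  obtain ⟨a, ha⟩ := exists_sum_wE_le m (fun w (z : Fin r → ZMod 8) =>
    Y (Fin.append w z) - ∑ i, b i * z i)
  refine ⟨_, ⟨Fin.append a b, rfl⟩, ?_⟩
  rw [distOn_macIdx r u wE (fun z => Y (Fin.append 0 z)) (fun z => ∑ i, b i * z i)] at hb
  rw [distOn_macIdx (m + r) u wE Y (fun v => ∑ i, Fin.append a b i * v i),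
    sum_eq_sum_append, ← Finset.add_sum_erase _ _ (Finset.mem_univ 0), add_comm]
  refine add_le_add (le_trans (Finset.sum_le_sum fun w hw => Finset.sum_le_sum fun z _ => ?_)
    (ha.trans_eq ?_)) (le_trans (Finset.sum_le_sum fun z _ => ?_) hb)
  · have hw' := Finset.ne_of_mem_erase hw
    rw [if_pos ((exists_append_ne_zero_iff hur.le w z).mpr (Or.inl hw'))]
    simp [Fin.sum_univ_add, sub_sub, add_comm]
  · simp [ZMod.card, pow_add, mul_assoc, Nat.sub_mul]
  · simp only [exists_append_ne_zero_iff hur.le]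
    simp [Fin.sum_univ_add]
end
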